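/- For every integer k ≥ 2, q(K_1 ∨ ((k−1)P_2 ∪ S_3)) > 2k + 2 + 1/k. -/

import Mathlib

namespace QPaper

open SimpleGraph

/-- The signless Laplacian matrix `Q(G) = D(G) + A(G)` of a graph, over `ℝ`. -/
noncomputable def signlessLap {V : Type*} [Fintype V] [DecidableEq V] (G : SimpleGraph V) :
    Matrix V V ℝ :=
  letI := Classical.decRel G.Adj
  G.degMatrix ℝ + G.adjMatrix ℝ

/-- The `Q`-index of a graph: the largest eigenvalue of its signless Laplacian matrix. -/
noncomputable def qIndex {V : Type*} [Fintype V] [DecidableEq V] (G : SimpleGraph V) : ℝ :=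
  sSup (spectrum ℝ (signlessLap G))

/-- The number of edges (size) of a graph. -/
noncomputable def numEdges {V : Type*} (G : SimpleGraph V) : ℕ :=
  Nat.card G.edgeSet

/-- The degree of a vertex. -/
noncomputable def deg {V : Type*} (G : SimpleGraph V) (v : V) : ℕ :=
  Nat.card (G.neighborSet v)

/-- A graph is `2` leaves-free if it has at most one vertex of degree one. -/
def TwoLeavesFree {V : Type*} (G : SimpleGraph V) : Prop :=
  ∀ u v : V, deg G u = 1 → deg G v = 1 → u = v

/-- The maximum degree `Δ(G)`. -/
noncomputable def maxDeg {V : Type*} [Fintype V] (G : SimpleGraph V) : ℕ :=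
  letI := Classical.decEq V
  letI := Classical.decRel G.Adj
  G.maxDegree

/-- `k` disjoint copies of `P₂`, i.e. a perfect matching on `2k` vertices. -/
def matching (k : ℕ) : SimpleGraph (Fin k × Fin 2) :=
  SimpleGraph.fromRel (fun a b => a.1 = b.1)

/-- The star graph `Sₙ` on `n` vertices (`K_{1,n-1}` with center `0`). -/
def starGraph (n : ℕ) : SimpleGraph (Fin n) :=
  SimpleGraph.fromRel (fun a _ => (a : ℕ) = 0)

/-- Disjoint union of two graphs. -/
def dUnion {α β : Type*} (G : SimpleGraph α) (H : SimpleGraph β) : SimpleGraph (α ⊕ β) :=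
  SimpleGraph.fromRel (fun a b =>
    (∃ x y, a = Sum.inl x ∧ b = Sum.inl y ∧ G.Adj x y) ∨
    (∃ x y, a = Sum.inr x ∧ b = Sum.inr y ∧ H.Adj x y))

/-- The join `K₁ ∨ H` : a new vertex (`none`) adjacent to every vertex of `H`. -/
def cone {α : Type*} (H : SimpleGraph α) : SimpleGraph (Option α) :=
  SimpleGraph.fromRel (fun a b =>
    a = none ∨ ∃ x y, a = some x ∧ b = some y ∧ H.Adj x y)

/-- The Rayleigh principle: a number strictly below some Rayleigh quotient of a real symmetric
matrix is strictly below its largest eigenvalue. -/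
theorem lt_sSup_spectrum_of_rayleigh {V : Type*} [Fintype V] [DecidableEq V] {A : Matrix V V ℝ}
    (hA : A.IsHermitian) {c : ℝ} (x : V → ℝ) (hx : c * (x ⬝ᵥ x) < x ⬝ᵥ A.mulVec x) :
    c < sSup (spectrum ℝ A) := by
  by_contra! hle
  have hH : (algebraMap ℝ (Matrix V V ℝ) c - A).IsHermitian := by
    refine Matrix.IsHermitian.sub ?_ hA
    rw [Matrix.algebraMap_eq_diagonal]
    exact Matrix.isHermitian_diagonal _
  have hP : (algebraMap ℝ (Matrix V V ℝ) c - A).PosSemidef := by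
    rw [hH.posSemidef_iff_eigenvalues_nonneg]
    intro i
    have hi := hH.eigenvalues_mem_spectrum_real i
    rw [← spectrum.singleton_sub_eq, Set.singleton_sub] at hi
    obtain ⟨μ, hμ, hi⟩ := hi
    have hμc := (le_csSup A.finite_real_spectrum.bddAbove hμ).trans hle
    simp only [Pi.zero_apply]
    linarith
  have h := hP.dotProduct_mulVec_nonneg x
  rw [Matrix.sub_mulVec, dotProduct_sub, Algebra.algebraMap_eq_smul_one, Matrix.smul_mulVec,
    Matrix.one_mulVec, dotProduct_smul, star_trivial, smul_eq_mul] at h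
  linarith

theorem isHermitian_signlessLap {V : Type*} [Fintype V] [DecidableEq V] (G : SimpleGraph V) :
    (signlessLap G).IsHermitian := by
  classical
  unfold signlessLap SimpleGraph.degMatrix
  exact (Matrix.isHermitian_diagonal _).add <| by
    rw [Matrix.IsHermitian, Matrix.conjTranspose_eq_transpose_of_trivial,
      SimpleGraph.transpose_adjMatrix]

theorem signlessLap_mulVec {V : Type*} [Fintype V] [DecidableEq V] (G : SimpleGraph V)
    [DecidableRel G.Adj] (x : V → ℝ) (v : V) :
    (signlessLap G).mulVec x v = ∑ w, if G.Adj v w then x v + x w else 0 := by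
  have : signlessLap G = G.degMatrix ℝ + G.adjMatrix ℝ := by
    unfold signlessLap
    congr!
  rw [this, Matrix.add_mulVec, Pi.add_apply, SimpleGraph.adjMatrix_mulVec_apply,
    SimpleGraph.degMatrix, Matrix.mulVec_diagonal, ← Finset.sum_filter, Finset.sum_add_distrib,
    ← SimpleGraph.neighborFinset_eq_filter]
  simp

@[simp]
theorem matching_adj {k : ℕ} {a b : Fin k × Fin 2} :
    (matching k).Adj a b ↔ a ≠ b ∧ a.1 = b.1 := by
  simp [matching, eq_comm]

@[simp]
theorem starGraph_adj {n : ℕ} {a b : Fin n} :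
    (starGraph n).Adj a b ↔ a ≠ b ∧ ((a : ℕ) = 0 ∨ (b : ℕ) = 0) := by
  simp [starGraph]

section Adjacency

variable {α β : Type*} {G : SimpleGraph α} {H : SimpleGraph β}

@[simp]
theorem dUnion_adj_inl_inl {a b : α} :
    (dUnion G H).Adj (Sum.inl a) (Sum.inl b) ↔ G.Adj a b := by
  simpa [dUnion, G.adj_comm b a] using G.ne_of_adj

@[simp]
theorem dUnion_adj_inr_inr {a b : β} :
    (dUnion G H).Adj (Sum.inr a) (Sum.inr b) ↔ H.Adj a b := by
  simpa [dUnion, H.adj_comm b a] using H.ne_of_adj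

@[simp]
theorem not_dUnion_adj_inl_inr {a : α} {b : β} : ¬(dUnion G H).Adj (Sum.inl a) (Sum.inr b) := by
  simp [dUnion]

@[simp]
theorem not_dUnion_adj_inr_inl {a : β} {b : α} : ¬(dUnion G H).Adj (Sum.inr a) (Sum.inl b) := by
  simp [dUnion]

@[simp]
theorem cone_adj_none_some {a : α} : (cone G).Adj none (some a) := by
  simp [cone]

@[simp]
theorem cone_adj_some_none {a : α} : (cone G).Adj (some a) none := by
  simp [cone]

@[simp]
theorem cone_adj_some_some {a b : α} : (cone G).Adj (some a) (some b) ↔ G.Adj a b := by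
  simpa [cone, G.adj_comm b a] using G.ne_of_adj

end Adjacency

/-- The vector on the vertices of `K₁ ∨ (mP₂ ∪ S₃)` with entry `1` at the apex, `a` on the copies
of `P₂`, `b` at the centre of the star and `c` at its leaves. -/
def testVector (m : ℕ) (a b c : ℝ) : Option ((Fin m × Fin 2) ⊕ Fin 3) → ℝ
  | none => 1
  | some (Sum.inl _) => a
  | some (Sum.inr i) => if i = 0 then b else c

theorem testVector_dotProduct_self (m : ℕ) (a b c : ℝ) :
    testVector m a b c ⬝ᵥ testVector m a b c = 1 + 2 * m * a ^ 2 + b ^ 2 + 2 * c ^ 2 := by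
  simp [dotProduct, Fintype.sum_option, Fintype.sum_sum_type, Fin.sum_univ_three, testVector]
  ring

theorem testVector_dotProduct_mulVec (m : ℕ) (a b c : ℝ) :
    testVector m a b c ⬝ᵥ
        (signlessLap (cone (dUnion (matching m) (starGraph 3)))).mulVec (testVector m a b c) =
      2 * m * (1 + a) ^ 2 + (1 + b) ^ 2 + 2 * (1 + c) ^ 2 + 4 * m * a ^ 2 + 2 * (b + c) ^ 2 := by
  classical
  simp [dotProduct, signlessLap_mulVec, Fintype.sum_option, Fintype.sum_sum_type,
    Fin.sum_univ_three, Fintype.sum_prod_type, Fin.sum_univ_two, testVector,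
    Finset.sum_add_distrib]
  ring

theorem stmt19 (k : ℕ) (hk : 2 ≤ k) :
    qIndex (cone (dUnion (matching (k - 1)) (starGraph 3))) > 2 * (k : ℝ) + 2 + 1 / (k : ℝ) := by
  obtain ⟨m, rfl⟩ : ∃ m, k = m + 1 := ⟨k - 1, by omega⟩
  rw [Nat.add_sub_cancel]
  have hm : (1 : ℝ) ≤ m := by exact_mod_cast (by omega : 1 ≤ m)
  push_cast
  set l : ℝ := 2 * ((m : ℝ) + 1) + 2 + 1 / ((m : ℝ) + 1) with hl
  have hl6 : 6 < l := by
    have : 0 < 1 / ((m : ℝ) + 1) := by positivity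
    linarith
  have h1 : 0 < l - 1 := by linarith
  have h3 : 0 < l - 3 := by linarith
  have h4 : 0 < l - 4 := by linarith
  have key : l < 2 * m + 3 + 2 * m / (l - 3) + (3 * l - 4) / ((l - 1) * (l - 4)) := by
    obtain ⟨t, ht, hmt⟩ : ∃ t : ℝ, 0 ≤ t ∧ (m : ℝ) = t + 1 := ⟨m - 1, by linarith, by ring⟩
    have hl' : l = (2 * t ^ 2 + 10 * t + 13) / (t + 2) := by
      rw [hl, hmt]
      field_simp
      ring
    have e1 : l - 1 = (2 * t ^ 2 + 9 * t + 11) / (t + 2) := by rw [hl']; field_simp; ring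
    have e3 : l - 3 = (2 * t ^ 2 + 7 * t + 7) / (t + 2) := by rw [hl']; field_simp; ring
    have e4 : l - 4 = (2 * t ^ 2 + 6 * t + 5) / (t + 2) := by rw [hl']; field_simp; ring
    rw [e1, e3, e4, hl', hmt, ← sub_pos]
    field_simp
    ring_nf
    positivity
  refine lt_sSup_spectrum_of_rayleigh (isHermitian_signlessLap _)
    (testVector m (1 / (l - 3)) (l / ((l - 1) * (l - 4))) ((l - 2) / ((l - 1) * (l - 4)))) ?_
  rw [testVector_dotProduct_self, testVector_dotProduct_mulVec, ← sub_pos]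
  rw [← sub_pos] at key
  convert key using 1
  field_simp
  ring

end QPaper
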